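/- Let V be a finite-dimensional real vector space, D ⊆ V × V* a subspace with D = D^⊥ with respect to the pairing form (a constant Dirac structure on V), and W ⊆ V a subspace. Then [D ∩ (W × V*)]^⊥ = D + ({0} × W°), where W° ⊆ V* is the annihilator of W. -/

import Mathlib

/-- The orthogonal of a subspace `D ⊆ V × V*` with respect to the pairing form
`⟨⟨(v,α),(w,β)⟩⟩ = α w + β v`. -/
def diracPerp {V : Type*} [AddCommGroup V] [Module ℝ V]
    (D : Submodule ℝ (V × Module.Dual ℝ V)) : Submodule ℝ (V × Module.Dual ℝ V) where
  carrier := {p | ∀ q ∈ D, q.2 p.1 + p.2 q.1 = 0}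
  zero_mem' := by
    intro q hq
    simp
  add_mem' := by
    intro a b ha hb q hq
    have h1 := ha q hq
    have h2 := hb q hq
    simp only [Prod.fst_add, Prod.snd_add, map_add, LinearMap.add_apply] at *
    linarith
  smul_mem' := by
    intro c a ha q hq
    have h := ha q hq
    simp only [Prod.smul_fst, Prod.smul_snd, map_smul, LinearMap.smul_apply, smul_eq_mul,
      Set.mem_setOf_eq] at *
    rw [← mul_add, h, mul_zero]

/-- For a constant Dirac structure `D = D^⊥` on `V` and a subspace `W ⊆ V`,
`[D ∩ (W × V*)]^⊥ = D + ({0} × W°)`. -/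
theorem diracPerp_inf_prod
    {V : Type*} [AddCommGroup V] [Module ℝ V] [FiniteDimensional ℝ V]
    (D : Submodule ℝ (V × Module.Dual ℝ V)) (hD : diracPerp D = D)
    (W : Submodule ℝ V) :
    diracPerp (D ⊓ W.prod (⊤ : Submodule ℝ (Module.Dual ℝ V)))
      = D ⊔ (⊥ : Submodule ℝ V).prod W.dualAnnihilator := by
  apply le_antisymm
  · intro p hp
    by_contra hpE
    rw [← Subspace.forall_mem_dualAnnihilator_apply_eq_zero_iff] at hpE
    apply hpE
    intro f hf
    rw [Submodule.mem_dualAnnihilator] at hf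
    obtain ⟨v, hv⟩ := (Module.evalEquiv ℝ V).surjective
      (f ∘ₗ LinearMap.inr ℝ V (Module.Dual ℝ V))
    have hv' : ∀ β : Module.Dual ℝ V, f (0, β) = β v := by
      intro β
      have := LinearMap.congr_fun hv β
      simpa using this.symm
    have hf' : ∀ x : V × Module.Dual ℝ V,
        f x = (f ∘ₗ LinearMap.inl ℝ V (Module.Dual ℝ V)) x.1 + x.2 v := by
      intro x
      rw [← hv']
      simp [← map_add]
    have hq : (v, f ∘ₗ LinearMap.inl ℝ V (Module.Dual ℝ V)) ∈
        D ⊓ W.prod (⊤ : Submodule ℝ (Module.Dual ℝ V)) := by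
      refine ⟨?_, ?_, trivial⟩
      · have h : (v, f ∘ₗ LinearMap.inl ℝ V (Module.Dual ℝ V)) ∈ diracPerp D := by
          intro q hq
          have h1 := hf q (Submodule.mem_sup_left hq)
          rw [hf'] at h1
          rw [add_comm]
          exact h1
        rwa [hD] at h
      · change v ∈ W
        rw [← Subspace.forall_mem_dualAnnihilator_apply_eq_zero_iff]
        intro β hβ
        rw [← hv']
        exact hf _ (Submodule.mem_sup_right ⟨Submodule.zero_mem _, hβ⟩)
    rw [hf']
    exact hp _ hq
  · refine sup_le ?_ ?_
    · intro p hp q hq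
      rw [← hD] at hp
      exact hp q hq.1
    · rintro ⟨w, β⟩ ⟨hw, hβ⟩ q hq
      have hw0 : w = 0 := hw
      have h2 : β q.1 = 0 := (Submodule.mem_dualAnnihilator _).1 hβ _ hq.2.1
      simp [hw0, h2]
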